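/- arXiv:2011.02724 — 3 statements merged into one kernel-verified Lean document; each statement's English description precedes it below -/
import Mathlib

section
/- Let K be a finite field with char(K) ≠ 2, L a field extension of K of finite degree k ≥ 1, and S = {restrictScalars_K(l) : l a 1-dimensional L-subspace of L²} the planar spread of the 2k-dimensional K-space L². Let M ∈ GL(2, L) have irreducible characteristic polynomial over L and multiplicative order |L|² − 1, and set H̄ = ⟨M^{|L|−1}⟩, acting K-linearly on L². Then the action of H̄ on S has exactly two orbits, each of cardinality (|L| + 1)/2. -/
open Module

/-- The planar spread of the `K`-vector space `L²` obtained by field reduction: the set of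
`K`-subspaces arising as `restrictScalars K` of the `L`-lines of `L²`. -/
def fieldReductionSpread (K L : Type*) [Field K] [Field L] [Algebra K L] :
    Set (Submodule K (Fin 2 → L)) :=
  {U | ∃ l : Submodule L (Fin 2 → L), finrank L l = 1 ∧ U = l.restrictScalars K}

/-- The `K`-linear action of `A ∈ GL(2, L)` on `K`-subspaces of `L²`: `U · A` is the image
of `U` under the (in particular `K`-linear) map given by the matrix `A`. -/
noncomputable def mapGLK (K : Type*) {L : Type*} [Field K] [Field L] [Algebra K L]
    (A : GL (Fin 2) L) (U : Submodule K (Fin 2 → L)) : Submodule K (Fin 2 → L) :=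
  U.map (LinearMap.restrictScalars K (Matrix.toLin' (A : Matrix (Fin 2) (Fin 2) L)))

lemma aux_no_eigen {L : Type*} [Field L] (M : Matrix (Fin 2) (Fin 2) L)
    (hirr : Irreducible M.charpoly) (v : Fin 2 → L) (hv : v ≠ 0) (a : L) :
    a • v ≠ M.mulVec v := by
  intro h
  have h1 : (Matrix.scalar (Fin 2) a - M).det = 0 := by
    rw [← Matrix.exists_mulVec_eq_zero_iff]
    refine ⟨v, hv, ?_⟩
    rw [Matrix.sub_mulVec, ← h, Matrix.scalar_apply, ← Matrix.smul_one_eq_diagonal,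
      Matrix.smul_mulVec, Matrix.one_mulVec, sub_self]
  rw [← Matrix.eval_charpoly] at h1
  have h2 := Polynomial.degree_eq_one_of_irreducible_of_root hirr h1
  have h3 := Matrix.charpoly_natDegree_eq_dim M
  rw [Polynomial.natDegree_eq_of_degree_eq_some (n := 1) h2] at h3
  simp at h3

lemma aux_scalar {L : Type*} [Field L] (M N : Matrix (Fin 2) (Fin 2) L)
    (hirr : Irreducible M.charpoly) (hc : N * M = M * N) (v : Fin 2 → L) (hv : v ≠ 0) (c : L)
    (h : N.mulVec v = c • v) : N = c • (1 : Matrix (Fin 2) (Fin 2) L) := by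
  have hli : LinearIndependent L ![v, M.mulVec v] :=
    (LinearIndependent.pair_iff' hv).2 (aux_no_eigen M hirr v hv)
  have hsp := hli.span_eq_top_of_card_eq_finrank' (by simp)
  have hle : Submodule.span L (Set.range ![v, M.mulVec v]) ≤
      LinearMap.ker (Matrix.toLin' (N - c • (1 : Matrix (Fin 2) (Fin 2) L))) := by
    rw [Submodule.span_le]
    rintro _ ⟨i, rfl⟩
    fin_cases i
    · change Matrix.toLin' _ v = 0
      rw [Matrix.toLin'_apply, Matrix.sub_mulVec, Matrix.smul_mulVec, h, Matrix.one_mulVec,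
        sub_self]
    · change Matrix.toLin' _ (M.mulVec v) = 0
      rw [Matrix.toLin'_apply, Matrix.sub_mulVec, Matrix.smul_mulVec, Matrix.one_mulVec,
        Matrix.mulVec_mulVec, hc, ← Matrix.mulVec_mulVec, h, Matrix.mulVec_smul, sub_self]
  rw [hsp, top_le_iff, LinearMap.ker_eq_top] at hle
  have := (LinearEquiv.map_eq_zero_iff _).1 hle
  exact sub_eq_zero.1 this

/-- The action of `GL(2, L)` on the `K`-subspaces of `L²`. -/
@[reducible] noncomputable def auxAct (K L : Type*) [Field K] [Field L] [Algebra K L] :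
    MulAction (GL (Fin 2) L) (Submodule K (Fin 2 → L)) where
  smul A U := mapGLK K A U
  one_smul U := by
    change mapGLK K 1 U = U
    ext x
    simp [mapGLK]
  mul_smul A B U := by
    change mapGLK K (A * B) U = mapGLK K A (mapGLK K B U)
    ext x
    simp [mapGLK, Matrix.toLin'_mul]

lemma aux_ncard_spread (K L : Type*) [Field K] [Field L] [Fintype L] [Algebra K L] :
    (fieldReductionSpread K L).ncard = Fintype.card L + 1 := by
  let f : Projectivization L (Fin 2 → L) → Submodule K (Fin 2 → L) :=
    fun P => P.submodule.restrictScalars K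
  have hf : Function.Injective f := fun P Q h =>
    Projectivization.submodule_injective (Submodule.restrictScalars_injective K _ _ h)
  have hr : fieldReductionSpread K L = Set.range f := by
    ext U
    constructor
    · rintro ⟨l, hl, rfl⟩
      exact ⟨Projectivization.mk'' l hl, by simp [f]⟩
    · rintro ⟨P, rfl⟩
      exact ⟨P.submodule, P.finrank_submodule, rfl⟩
  rw [hr, Set.ncard_range_of_injective hf,
    Projectivization.card_of_finrank_two L (Fin 2 → L) (by simp), Nat.card_eq_fintype_card]

lemma aux_spread_stable {K L : Type*} [Field K] [Field L] [Algebra K L]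
    (A : GL (Fin 2) L) (U : Submodule K (Fin 2 → L)) (hU : U ∈ fieldReductionSpread K L) :
    mapGLK K A U ∈ fieldReductionSpread K L := by
  obtain ⟨l, hl, rfl⟩ := hU
  refine ⟨l.map (Matrix.toLin' (A : Matrix (Fin 2) (Fin 2) L)), ?_, ?_⟩
  · have hinj : Function.Injective (Matrix.toLin' (A : Matrix (Fin 2) (Fin 2) L)) := by
      intro x y h
      rw [Matrix.toLin'_apply, Matrix.toLin'_apply] at h
      exact Matrix.mulVec_injective_of_isUnit A.isUnit h
    rw [← hl]
    exact (Submodule.equivMapOfInjective _ hinj l).finrank_eq.symm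
  · ext x
    simp [mapGLK]

lemma aux_fix {K L : Type*} [Field K] [Field L] [Fintype L] [Algebra K L]
    (M : GL (Fin 2) L)
    (hirr : Irreducible (Matrix.charpoly (M : Matrix (Fin 2) (Fin 2) L)))
    (hord : orderOf M = Fintype.card L ^ 2 - 1)
    (U : Submodule K (Fin 2 → L)) (hU : U ∈ fieldReductionSpread K L) (p : ℕ)
    (hp : mapGLK K (M ^ p) U = U) : Fintype.card L + 1 ∣ p := by
  obtain ⟨l, hl, rfl⟩ := hU
  obtain ⟨v, hv, hspan⟩ := finrank_eq_one_iff'.1 hl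
  have hv' : (v : Fin 2 → L) ≠ 0 := by simpa using hv
  have hmem : (((M ^ p : GL (Fin 2) L) : Matrix (Fin 2) (Fin 2) L)).mulVec v ∈ l := by
    have : (((M ^ p : GL (Fin 2) L) : Matrix (Fin 2) (Fin 2) L)).mulVec v ∈
        mapGLK K (M ^ p) (l.restrictScalars K) :=
      ⟨v, v.2, Matrix.toLin'_apply _ _⟩
    rw [hp] at this
    exact this
  obtain ⟨c, hc⟩ := hspan ⟨_, hmem⟩
  have hc' := congrArg Subtype.val hc
  simp only [Submodule.coe_smul] at hc'
  have hsc := aux_scalar _ _ hirr (by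
    rw [Units.val_pow_eq_pow_val, ← pow_succ, ← pow_succ']) _ hv' c hc'.symm
  have hc0 : c ≠ 0 := by
    rintro rfl
    rw [zero_smul] at hsc
    exact (M ^ p).ne_zero hsc
  have h1 : (M ^ p) ^ (Fintype.card L - 1) = 1 := by
    apply Units.ext
    rw [Units.val_pow_eq_pow_val, hsc, smul_pow, FiniteField.pow_card_sub_one_eq_one c hc0]
    simp
  rw [← pow_mul] at h1
  have h2 := orderOf_dvd_of_pow_eq_one h1
  have hq : 1 < Fintype.card L := Fintype.one_lt_card
  have h3 : Fintype.card L ^ 2 - 1 = (Fintype.card L + 1) * (Fintype.card L - 1) := by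
    simpa using Nat.sq_sub_sq (Fintype.card L) 1
  rw [hord, h3] at h2
  exact Nat.dvd_of_mul_dvd_mul_right (by omega) h2

lemma aux_orbit_ncard {K L : Type*} [Field K] [Field L] [Fintype L] [Algebra K L]
    (hodd : Fintype.card L % 2 = 1)
    (M : GL (Fin 2) L)
    (hirr : Irreducible (Matrix.charpoly (M : Matrix (Fin 2) (Fin 2) L)))
    (hord : orderOf M = Fintype.card L ^ 2 - 1)
    (U : Submodule K (Fin 2 → L)) (hU : U ∈ fieldReductionSpread K L) :
    letI := auxAct K L
    (MulAction.orbit (Subgroup.zpowers (M ^ (Fintype.card L - 1))) U).ncard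
      = (Fintype.card L + 1) / 2 := by
  letI := auxAct K L
  classical
  have hq : 1 < Fintype.card L := Fintype.one_lt_card
  have hfin : (fieldReductionSpread K L).Finite :=
    Set.finite_of_ncard_pos (by rw [aux_ncard_spread]; omega)
  have hsub : ∀ g : GL (Fin 2) L,
      MulAction.orbit (Subgroup.zpowers g) U ⊆ fieldReductionSpread K L := by
    rintro g _ ⟨A, rfl⟩
    exact aux_spread_stable A.1 U hU
  have hper : ∀ g : GL (Fin 2) L, Function.minimalPeriod (fun x => g • x) U
      = (MulAction.orbit (Subgroup.zpowers g) U).ncard := by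
    intro g
    haveI : Fintype (MulAction.orbit (Subgroup.zpowers g) U) := (hfin.subset (hsub g)).fintype
    rw [MulAction.minimalPeriod_eq_card, ← Nat.card_eq_fintype_card, Nat.card_coe_set_eq]
  have hM : Function.minimalPeriod (fun x => M • x) U = Fintype.card L + 1 := by
    have h1 : Fintype.card L + 1 ∣ Function.minimalPeriod (fun x => M • x) U :=
      aux_fix M hirr hord U hU _ ((MulAction.pow_smul_eq_iff_minimalPeriod_dvd (a := M) (b := U)).2 dvd_rfl)
    have h2 : Function.minimalPeriod (fun x => M • x) U ≤ Fintype.card L + 1 := by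
      rw [hper, ← aux_ncard_spread K L]
      exact Set.ncard_le_ncard (hsub M) hfin
    have h3 : 0 < Function.minimalPeriod (fun x => M • x) U := by
      rw [hper, Set.ncard_pos (hfin.subset (hsub M))]
      exact MulAction.nonempty_orbit U
    exact le_antisymm h2 (Nat.le_of_dvd h3 h1)
  rw [← hper, ← smul_iterate, Function.minimalPeriod_iterate_eq_div_gcd (by omega), hM]
  congr 1
  obtain ⟨m, hm⟩ : ∃ m, Fintype.card L = 2 * m + 1 := ⟨Fintype.card L / 2, by omega⟩
  rw [hm, show 2 * m + 1 + 1 = 2 * (m + 1) by ring, show 2 * m + 1 - 1 = 2 * m by omega,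
    Nat.gcd_mul_left]
  simp

/-- Let `K` be a finite field of odd characteristic, `L/K` an extension of
degree `k ≥ 1`, `S` the planar spread of the `K`-space `L²` by field reduction,
`M ∈ GL(2, L)` a Singer cycle and `H̄ = ⟨M^{|L|−1}⟩`. Then the action of `H̄` on `S` has
exactly two orbits, each of cardinality `(|L| + 1)/2`. -/
theorem singer_subgroup_two_orbits_on_spread_char_ne_two
    {K L : Type*} [Field K] [Fintype K] [Field L] [Fintype L] [Algebra K L]
    (hchar : ringChar K ≠ 2)
    (k : ℕ) (hk : 1 ≤ k) (hdeg : finrank K L = k)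
    (M : GL (Fin 2) L)
    (hirr : Irreducible (Matrix.charpoly (M : Matrix (Fin 2) (Fin 2) L)))
    (hord : orderOf M = Fintype.card L ^ 2 - 1) :
    {Ω : Set (Submodule K (Fin 2 → L)) | ∃ U ∈ fieldReductionSpread K L,
        Ω = {U' | ∃ A ∈ Subgroup.zpowers (M ^ (Fintype.card L - 1)),
          U' = mapGLK K A U}}.ncard = 2
    ∧ ∀ U ∈ fieldReductionSpread K L,
        {U' | ∃ A ∈ Subgroup.zpowers (M ^ (Fintype.card L - 1)),
          U' = mapGLK K A U}.ncard = (Fintype.card L + 1) / 2 := by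
  classical
  letI := auxAct K L
  have hodd : Fintype.card L % 2 = 1 :=
    FiniteField.odd_card_of_char_ne_two (by rwa [← Algebra.ringChar_eq K L])
  set g := M ^ (Fintype.card L - 1) with hg
  have horb : ∀ U : Submodule K (Fin 2 → L),
      {U' | ∃ A ∈ Subgroup.zpowers g, U' = mapGLK K A U}
        = MulAction.orbit (Subgroup.zpowers g) U := by
    intro U
    ext U'
    constructor
    · rintro ⟨A, hA, rfl⟩
      exact ⟨⟨A, hA⟩, rfl⟩
    · rintro ⟨A, rfl⟩
      exact ⟨A.1, A.2, rfl⟩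
  have hcard : ∀ U ∈ fieldReductionSpread K L,
      (MulAction.orbit (Subgroup.zpowers g) U).ncard = (Fintype.card L + 1) / 2 :=
    fun U hU => aux_orbit_ncard hodd M hirr hord U hU
  simp only [horb]
  refine ⟨?_, hcard⟩
  have hfin : (fieldReductionSpread K L).Finite :=
    Set.finite_of_ncard_pos (by rw [aux_ncard_spread]; omega)
  have hS := aux_ncard_spread K L
  rw [Set.ncard_eq_toFinset_card _ hfin,
    Finset.card_eq_sum_card_image (fun U => MulAction.orbit (Subgroup.zpowers g) U),
    Finset.sum_const_nat (m := (Fintype.card L + 1) / 2)] at hS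
  · have hT : {Ω : Set (Submodule K (Fin 2 → L)) | ∃ U ∈ fieldReductionSpread K L,
        Ω = MulAction.orbit (Subgroup.zpowers g) U}
        = ((hfin.toFinset.image (fun U => MulAction.orbit (Subgroup.zpowers g) U) :
          Finset (Set (Submodule K (Fin 2 → L)))) : Set (Set (Submodule K (Fin 2 → L)))) := by
      ext Ω
      simp [eq_comm]
    rw [hT, Set.ncard_coe_finset]
    obtain ⟨m, hm⟩ : ∃ m, Fintype.card L = 2 * m + 1 := ⟨Fintype.card L / 2, by omega⟩
    have hd : (Fintype.card L + 1) / 2 = m + 1 := by omega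
    rw [hd, hm, show 2 * m + 1 + 1 = 2 * (m + 1) by ring] at hS
    exact Nat.eq_of_mul_eq_mul_right (by omega) hS
  · intro Ω hΩ
    obtain ⟨U, hU, rfl⟩ := Finset.mem_image.1 hΩ
    have hU' : U ∈ fieldReductionSpread K L := by simpa using hU
    rw [← hcard U hU', ← Set.ncard_coe_finset]
    congr 1
    ext V
    simp only [Finset.coe_filter, Set.Finite.mem_toFinset, Set.mem_setOf_eq,
      MulAction.orbit_eq_iff]
    refine ⟨fun h => h.2, fun h => ⟨?_, h⟩⟩
    obtain ⟨A, rfl⟩ := h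
    exact aux_spread_stable A.1 U hU'
end

section
/- Let K be a finite field with char(K) ≠ 2, L a field extension of K of finite degree k ≥ 1, and S = {restrictScalars_K(l) : l a 1-dimensional L-subspace of L²} the planar spread of the 2k-dimensional K-space L². Let M ∈ GL(2, L) have irreducible characteristic polynomial over L and multiplicative order |L|² − 1, and set H̄ = ⟨M^{|L|−1}⟩, acting K-linearly on L². Let F = (F_1, …, F_{2k−1}) be a full flag of K-subspaces of L² with F_k ∈ S. Then the orbit flag code Orb_{H̄}(F) = {F·A : A ∈ H̄} has cardinality (|L| + 1)/2, and any two distinct flags in Orb_{H̄}(F) have flag distance exactly 2k² (the maximum possible); in particular Orb_{H̄}(F) is an optimum distance full flag code. -/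
open Module

/-- The subspace distance `d_S(U, W) = dim U + dim W − 2 dim(U ∩ W)`. -/
noncomputable def subspaceDist {F V : Type*} [Field F] [AddCommGroup V] [Module F V]
    (U W : Submodule F V) : ℕ :=
  finrank F U + finrank F W - 2 * finrank F ↥(U ⊓ W)

/-- The orbit flag code of a full flag `Fl` of `K`-subspaces of `L²` (indexed so that `Fl i`
has `K`-dimension `i` for `1 ≤ i ≤ 2k−1`) under a subgroup `H ≤ GL(2, L)` acting
`K`-linearly, recorded as a set of `(2k−1)`-tuples of `K`-subspaces. -/
noncomputable def orbFlagKL {K L : Type*} [Field K] [Field L] [Algebra K L]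
    (H : Subgroup (GL (Fin 2) L)) (k : ℕ) (Fl : ℕ → Submodule K (Fin 2 → L)) :
    Set (Fin (2 * k - 1) → Submodule K (Fin 2 → L)) :=
  {G | ∃ A ∈ H, G = fun j => mapGLK K A (Fl (j.val + 1))}


lemma sg_no_eig {L : Type*} [Field L] (M : Matrix (Fin 2) (Fin 2) L)
    (hirr : Irreducible M.charpoly) (v : Fin 2 → L) (hv : v ≠ 0) (c : L) :
    M.mulVec v ≠ c • v := by
  intro h
  have hev : Module.End.HasEigenvalue (Matrix.toLin' M) c :=
    Module.End.hasEigenvalue_of_hasEigenvector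
      (x := v) ⟨by rw [Module.End.mem_eigenspace_iff]; simpa using h, hv⟩
  have hr : M.charpoly.IsRoot c := by
    have := (Module.End.hasEigenvalue_iff_isRoot_charpoly (Matrix.toLin' M) c).1 hev
    simpa using this
  have h1 := Polynomial.degree_eq_one_of_irreducible_of_root hirr hr
  rw [Matrix.charpoly_degree_eq_dim] at h1
  simp at h1

lemma sg_scalar {L : Type*} [Field L] (M A : Matrix (Fin 2) (Fin 2) L)
    (hirr : Irreducible M.charpoly) (hc : Commute A M) (v : Fin 2 → L) (hv : v ≠ 0) (c : L)
    (h : A.mulVec v = c • v) : A = c • (1 : Matrix (Fin 2) (Fin 2) L) := by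
  have hli : LinearIndependent L ![v, M.mulVec v] := by
    rw [LinearIndependent.pair_iff' hv]
    intro a ha
    exact sg_no_eig M hirr v hv a ha.symm
  have hspan : Submodule.span L (Set.range ![v, M.mulVec v]) = ⊤ :=
    hli.span_eq_top_of_card_eq_finrank' (by simp)
  have h2 : A.mulVec (M.mulVec v) = c • M.mulVec v := by
    rw [Matrix.mulVec_mulVec, hc.eq, ← Matrix.mulVec_mulVec, h, Matrix.mulVec_smul]
  have hle : Submodule.span L (Set.range ![v, M.mulVec v])
      ≤ LinearMap.eqLocus (Matrix.toLin' A) (c • LinearMap.id) := by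
    rw [Submodule.span_le]
    rintro x ⟨i, rfl⟩
    fin_cases i
    · simpa [LinearMap.mem_eqLocus] using h
    · simpa [LinearMap.mem_eqLocus] using h2
  rw [hspan] at hle
  apply Matrix.toLin'.injective
  apply LinearMap.ext
  intro x
  have := hle (Submodule.mem_top (x := x))
  rw [LinearMap.mem_eqLocus] at this
  rw [this]
  simp

lemma sg_mapGLK_mul {K L : Type*} [Field K] [Field L] [Algebra K L]
    (A B : GL (Fin 2) L) (U : Submodule K (Fin 2 → L)) :
    mapGLK K (A * B) U = mapGLK K A (mapGLK K B U) := by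
  unfold mapGLK
  rw [← Submodule.map_comp]
  congr 1
  apply LinearMap.ext
  intro x
  simp [Matrix.mulVec_mulVec]

lemma sg_mapGLK_smul {K L : Type*} [Field K] [Field L] [Algebra K L]
    (A : GL (Fin 2) L) (U : Submodule K (Fin 2 → L))
    (hA : A ^ 2 = 1) (c : L) (hAc : (A : Matrix (Fin 2) (Fin 2) L) = c • 1) :
    mapGLK K A U = U := by
  have hc : c = 1 ∨ c = -1 := by
    have h1 := congrArg (fun X : GL (Fin 2) L => (X : Matrix (Fin 2) (Fin 2) L) 0 0) hA
    simp [pow_two, hAc] at h1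
    exact mul_self_eq_one_iff.1 h1
  unfold mapGLK
  rw [hAc]
  rcases hc with rfl | rfl
  · ext x
    simp
  · ext x
    simp

lemma sg_finrank_mapGLK {K L : Type*} [Field K] [Field L] [Algebra K L]
    (A : GL (Fin 2) L) (U : Submodule K (Fin 2 → L)) :
    finrank K (mapGLK K A U) = finrank K U := by
  refine ((Submodule.equivMapOfInjective _ ?_ U).finrank_eq).symm
  intro x y hxy
  have hxy' : (A : Matrix (Fin 2) (Fin 2) L).mulVec x = (A : Matrix (Fin 2) (Fin 2) L).mulVec y := by
    simpa using hxy
  exact Matrix.mulVec_injective_of_isUnit A.isUnit hxy'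

lemma sg_eig_of_inter {K L : Type*} [Field K] [Field L] [Algebra K L]
    (A B : GL (Fin 2) L) (l : Submodule L (Fin 2 → L)) (hl : finrank L l = 1)
    (h : mapGLK K A (l.restrictScalars K) ⊓ mapGLK K B (l.restrictScalars K) ≠ ⊥) :
    ∃ (c : L) (v : Fin 2 → L), v ≠ 0 ∧
      ((B⁻¹ * A : GL (Fin 2) L) : Matrix (Fin 2) (Fin 2) L).mulVec v = c • v := by
  obtain ⟨x, hx, hx0⟩ := Submodule.exists_mem_ne_zero_of_ne_bot h
  obtain ⟨⟨u, hu, hux⟩, ⟨w, hw, hwx⟩⟩ := hx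
  have hux' : (A : Matrix (Fin 2) (Fin 2) L).mulVec u = x := by simpa using hux
  have hwx' : (B : Matrix (Fin 2) (Fin 2) L).mulVec w = x := by simpa using hwx
  have hu0 : u ≠ 0 := by
    rintro rfl
    apply hx0
    rw [← hux']; simp
  have hu' : u ∈ l := hu
  have hw' : w ∈ l := hw
  obtain ⟨c, hc⟩ := (finrank_eq_one_iff_of_nonzero' (⟨u, hu'⟩ : l)
    (by simpa [Subtype.ext_iff] using hu0)).1 hl ⟨w, hw'⟩
  have hc' : c • u = w := congrArg Subtype.val hc
  refine ⟨c, u, hu0, ?_⟩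
  rw [hc', Units.val_mul, ← Matrix.mulVec_mulVec, hux', ← hwx', Matrix.mulVec_mulVec,
    ← Units.val_mul]
  simp

lemma sg_sum (k : ℕ) (hk : 1 ≤ k) (f : ℕ → ℕ)
    (h1 : ∀ i, 1 ≤ i → i ≤ k → f i = 2 * i)
    (h2 : ∀ i, k ≤ i → i ≤ 2 * k - 1 → f i = 4 * k - 2 * i) :
    ∑ j : Fin (2 * k - 1), f (j.val + 1) = 2 * k ^ 2 := by
  rw [Fin.sum_univ_eq_sum_range (fun j => f (j + 1))]
  obtain ⟨n, rfl⟩ : ∃ n, k = n + 1 := ⟨k - 1, by omega⟩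
  have e : 2 * (n + 1) - 1 = (n + 1) + n := by omega
  rw [e, Finset.sum_range_add]
  have s1 : ∑ x ∈ Finset.range (n + 1), f (x + 1) = (n + 1) * (n + 2) := by
    rw [Finset.sum_congr rfl (g := fun x => 2 * (x + 1))
      (fun x hx => h1 _ (by omega) (by have := Finset.mem_range.1 hx; omega))]
    clear * -
    induction n with
    | zero => simp
    | succ m ih => rw [Finset.sum_range_succ, ih]; ring
  have s2 : ∑ x ∈ Finset.range n, f (n + 1 + x + 1) = n * (n + 1) := by
    rw [Finset.sum_congr rfl (g := fun x => 2 * (n - 1 - x + 1))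
      (fun x hx => by
        have := Finset.mem_range.1 hx
        rw [h2 _ (by omega) (by omega)]; omega)]
    rw [Finset.sum_range_reflect (fun x => 2 * (x + 1))]
    clear * -
    induction n with
    | zero => simp
    | succ m ih => rw [Finset.sum_range_succ, ih]; ring
  rw [s1, s2]; ring

lemma sg_dist {K L : Type*} [Field K] [Fintype K] [Field L] [Fintype L] [Algebra K L]
    (k : ℕ) (hk : 1 ≤ k) (hdeg : finrank K L = k)
    (Fl : ℕ → Submodule K (Fin 2 → L))
    (hdim : ∀ i, 1 ≤ i → i ≤ 2 * k - 1 → finrank K (Fl i) = i)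
    (hmono : ∀ i j, 1 ≤ i → i < j → j ≤ 2 * k - 1 → Fl i < Fl j)
    (A B : GL (Fin 2) L) (h : mapGLK K A (Fl k) ⊓ mapGLK K B (Fl k) = ⊥) :
    ∑ j : Fin (2 * k - 1), subspaceDist (mapGLK K A (Fl (j.val + 1)))
      (mapGLK K B (Fl (j.val + 1))) = 2 * k ^ 2 := by
  have hm : ∀ i j, 1 ≤ i → i ≤ j → j ≤ 2 * k - 1 → Fl i ≤ Fl j := by
    intro i j hi hij hj
    rcases hij.eq_or_lt with rfl | hlt
    · exact le_rfl
    · exact (hmono i j hi hlt hj).le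
  have hV : finrank K (Fin 2 → L) = 2 * k := by
    rw [finrank_pi_fintype]; simp [hdeg]
  apply sg_sum k hk
    (fun i => subspaceDist (mapGLK K A (Fl i)) (mapGLK K B (Fl i)))
  · intro i hi hik
    have hb : mapGLK K A (Fl i) ⊓ mapGLK K B (Fl i) = ⊥ := by
      rw [eq_bot_iff, ← h]
      exact inf_le_inf (Submodule.map_mono (hm i k hi hik (by omega)))
        (Submodule.map_mono (hm i k hi hik (by omega)))
    have hb' : finrank K ↥(mapGLK K A (Fl i) ⊓ mapGLK K B (Fl i)) = 0 := by
      rw [hb, finrank_bot]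
    simp only [subspaceDist, sg_finrank_mapGLK, hdim i hi (by omega)]
    omega
  · intro i hki hi
    have hk1 := Submodule.finrank_sup_add_finrank_inf_eq (mapGLK K A (Fl k)) (mapGLK K B (Fl k))
    rw [h, finrank_bot, sg_finrank_mapGLK, sg_finrank_mapGLK, hdim k hk (by omega)] at hk1
    have hle : mapGLK K A (Fl k) ⊔ mapGLK K B (Fl k) ≤ mapGLK K A (Fl i) ⊔ mapGLK K B (Fl i) :=
      sup_le_sup (Submodule.map_mono (hm k i hk hki hi)) (Submodule.map_mono (hm k i hk hki hi))
    have h3 := Submodule.finrank_mono hle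
    have h4 := Submodule.finrank_le (mapGLK K A (Fl i) ⊔ mapGLK K B (Fl i))
    have h5 := Submodule.finrank_sup_add_finrank_inf_eq (mapGLK K A (Fl i)) (mapGLK K B (Fl i))
    rw [sg_finrank_mapGLK, sg_finrank_mapGLK, hdim i (by omega) hi] at h5
    simp only [subspaceDist, sg_finrank_mapGLK, hdim i (by omega) hi]
    omega

/-- Let `K` be a finite field of odd characteristic, `L/K` an extension of
degree `k ≥ 1`, `S` the planar spread of the `K`-space `L²`, `M ∈ GL(2, L)` a Singer cycle
and `H̄ = ⟨M^{|L|−1}⟩`. For any full flag `F = (F_1, …, F_{2k−1})` of `K`-subspaces of `L²`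
with `F_k ∈ S`, the orbit flag code `Orb_{H̄}(F)` has cardinality `(|L| + 1)/2` and any two
distinct flags in it are at flag distance exactly `2k²`. -/
theorem singer_orbit_flag_code_char_ne_two
    {K L : Type*} [Field K] [Fintype K] [Field L] [Fintype L] [Algebra K L]
    (hchar : ringChar K ≠ 2)
    (k : ℕ) (hk : 1 ≤ k) (hdeg : finrank K L = k)
    (M : GL (Fin 2) L)
    (hirr : Irreducible (Matrix.charpoly (M : Matrix (Fin 2) (Fin 2) L)))
    (hord : orderOf M = Fintype.card L ^ 2 - 1)
    (Fl : ℕ → Submodule K (Fin 2 → L))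
    (hdim : ∀ i, 1 ≤ i → i ≤ 2 * k - 1 → finrank K (Fl i) = i)
    (hmono : ∀ i j, 1 ≤ i → i < j → j ≤ 2 * k - 1 → Fl i < Fl j)
    (hFk : Fl k ∈ fieldReductionSpread K L) :
    (orbFlagKL (Subgroup.zpowers (M ^ (Fintype.card L - 1))) k Fl).ncard
        = (Fintype.card L + 1) / 2
    ∧ ∀ G ∈ orbFlagKL (Subgroup.zpowers (M ^ (Fintype.card L - 1))) k Fl,
      ∀ G' ∈ orbFlagKL (Subgroup.zpowers (M ^ (Fintype.card L - 1))) k Fl,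
        G ≠ G' → ∑ j : Fin (2 * k - 1), subspaceDist (G j) (G' j) = 2 * k ^ 2 := by
  classical
  obtain ⟨l, hl, hFl⟩ := hFk
  set q := Fintype.card L with hq
  have hq1 : 1 < q := Fintype.one_lt_card
  have hodd : q % 2 = 1 := FiniteField.odd_card_of_char_ne_two
    (by rw [← Algebra.ringChar_eq K L]; exact hchar)
  obtain ⟨m, hm⟩ : ∃ m, q + 1 = 2 * m := ⟨(q + 1) / 2, by omega⟩
  set g := M ^ (q - 1) with hg
  have hgord : orderOf g = q + 1 := by
    have hfac : q ^ 2 - 1 = (q + 1) * (q - 1) := by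
      have := Nat.sq_sub_sq q 1
      simpa using this
    rw [hg, orderOf_pow_of_dvd (by omega) (by rw [hord, hfac]; exact dvd_mul_left _ _), hord, hfac]
    exact Nat.mul_div_cancel _ (by omega)
  have hgq : g ^ (q + 1) = 1 := by rw [← hgord]; exact pow_orderOf_eq_one g
  have hcomm : ∀ A ∈ Subgroup.zpowers g,
      Commute (A : Matrix (Fin 2) (Fin 2) L) (M : Matrix (Fin 2) (Fin 2) L) := by
    rintro A ⟨z, rfl⟩
    have : Commute (g ^ z) M := ((Commute.refl M).pow_left (q - 1)).zpow_left z
    exact congrArg Units.val this.eq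
  -- elements of the group with an eigenvector are scalar of square one
  have hkey : ∀ A ∈ Subgroup.zpowers g, ∀ (c : L) (v : Fin 2 → L), v ≠ 0 →
      (A : Matrix (Fin 2) (Fin 2) L).mulVec v = c • v →
      A ^ 2 = 1 ∧ (A : Matrix (Fin 2) (Fin 2) L) = c • 1 := by
    intro A hA c v hv h
    have hs := sg_scalar _ _ hirr (hcomm A hA) v hv c h
    refine ⟨?_, hs⟩
    have hA1 : A ^ (q + 1) = 1 := by
      obtain ⟨z, rfl⟩ := hA
      change (g ^ z) ^ (q + 1) = 1
      rw [← zpow_natCast, ← zpow_mul, mul_comm, zpow_mul, zpow_natCast, hgq, one_zpow]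
    have hcq : c ^ (q + 1) = 1 := by
      have h1 := congrArg (fun X : GL (Fin 2) L => (X : Matrix (Fin 2) (Fin 2) L) 0 0) hA1
      simpa [hs, smul_pow] using h1
    have hc2 : c ^ 2 = 1 := by
      have : c ^ (q + 1) = c ^ 2 := by
        rw [pow_succ, hq, FiniteField.pow_card, pow_two]
      rw [← this, hcq]
    apply Units.ext
    rw [Units.val_pow_eq_pow_val, hs, smul_pow, hc2]
    simp
  -- the dichotomy
  have hdich : ∀ A ∈ Subgroup.zpowers g, ∀ B ∈ Subgroup.zpowers g,
      mapGLK K A (Fl k) ⊓ mapGLK K B (Fl k) ≠ ⊥ →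
      (B⁻¹ * A) ^ 2 = 1 ∧ ∀ U : Submodule K (Fin 2 → L), mapGLK K A U = mapGLK K B U := by
    intro A hA B hB h
    rw [hFl] at h
    obtain ⟨c, v, hv, hcv⟩ := sg_eig_of_inter A B l hl h
    obtain ⟨h1, h2⟩ := hkey _ (mul_mem (inv_mem hB) hA) c v hv hcv
    refine ⟨h1, fun U => ?_⟩
    have : A = B * (B⁻¹ * A) := by group
    rw [this, sg_mapGLK_mul, sg_mapGLK_smul _ _ h1 c h2]
  have hgm : ∀ U : Submodule K (Fin 2 → L), mapGLK K (g ^ m) U = U := by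
    have hne : g ^ m ≠ 1 := by
      intro h
      have := Nat.le_of_dvd (by omega) (orderOf_dvd_of_pow_eq_one h)
      omega
    have hsq : (g ^ m) ^ 2 = 1 := by rw [← pow_mul, mul_comm, ← hm, hgq]
    have hX2 : ((g ^ m : GL (Fin 2) L) : Matrix (Fin 2) (Fin 2) L) *
        ((g ^ m : GL (Fin 2) L) : Matrix (Fin 2) (Fin 2) L) = 1 := by
      rw [← Units.val_mul, ← pow_two, hsq, Units.val_one]
    obtain ⟨w, hw⟩ : ∃ w, ((g ^ m : GL (Fin 2) L) : Matrix (Fin 2) (Fin 2) L).mulVec w ≠ w := by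
      by_contra! hcon
      apply hne
      apply Units.ext
      apply Matrix.toLin'.injective
      apply LinearMap.ext
      intro x
      rw [Matrix.toLin'_apply, Matrix.toLin'_apply, hcon x]
      simp
    generalize hX : g ^ m = X at *
    have hXm : X ∈ Subgroup.zpowers g := ⟨m, by rw [← hX]; simp⟩
    obtain ⟨h1, h2⟩ := hkey X hXm (-1)
      ((X : Matrix (Fin 2) (Fin 2) L).mulVec w - w) (sub_ne_zero.2 hw) (by
        rw [Matrix.mulVec_sub, Matrix.mulVec_mulVec, hX2]
        simp)
    exact fun U => sg_mapGLK_smul X U h1 _ h2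
  have hgmz : ∀ (z : ℤ) (U : Submodule K (Fin 2 → L)), mapGLK K ((g ^ m) ^ z) U = U := by
    have h1 : ∀ U : Submodule K (Fin 2 → L), mapGLK K 1 U = U := by
      intro U
      ext x
      simp [mapGLK]
    have hn : ∀ (n : ℕ) (U : Submodule K (Fin 2 → L)), mapGLK K ((g ^ m) ^ n) U = U := by
      intro n U
      induction n with
      | zero => rw [pow_zero, h1]
      | succ n ih => rw [pow_succ, sg_mapGLK_mul, hgm, ih]
    intro z U
    obtain ⟨n, rfl | rfl⟩ := z.eq_nat_or_neg
    · rw [zpow_natCast, hn]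
    · conv_lhs => rw [← hn n U]
      rw [← sg_mapGLK_mul, zpow_neg, zpow_natCast, inv_mul_cancel, h1]
  refine ⟨?_, ?_⟩
  · have himg : orbFlagKL (Subgroup.zpowers g) k Fl =
        (fun n : ℕ => fun j : Fin (2 * k - 1) => mapGLK K (g ^ n) (Fl (j.val + 1))) ''
          (Finset.range m : Set ℕ) := by
      ext G
      constructor
      · rintro ⟨A, ⟨z, rfl⟩, rfl⟩
        have hm0 : (m : ℤ) ≠ 0 := by omega
        have hz0 := Int.emod_nonneg z hm0
        have hz1 := Int.emod_lt_of_pos z (b := (m : ℤ)) (by omega)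
        refine ⟨(z % m).toNat, ?_, ?_⟩
        · rw [Finset.mem_coe, Finset.mem_range]; omega
        · funext j
          have hz : g ^ z = g ^ ((z % m).toNat) * (g ^ m) ^ (z / m) := by
            rw [← zpow_natCast, ← zpow_natCast g m, ← zpow_mul, ← zpow_add, Int.toNat_of_nonneg hz0,
              Int.emod_add_mul_ediv]
          change mapGLK K (g ^ ((z % m).toNat)) _ = mapGLK K (g ^ z) _
          rw [hz, sg_mapGLK_mul, hgmz]
      · rintro ⟨n, -, rfl⟩
        exact ⟨g ^ n, ⟨n, by simp⟩, rfl⟩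
    rw [himg, Set.ncard_image_of_injOn, Set.ncard_coe_finset, Finset.card_range]
    · omega
    · have hlem : ∀ a b : ℕ, a ≤ b → b < m →
          mapGLK K (g ^ b) (Fl k) = mapGLK K (g ^ a) (Fl k) → a = b := by
        intro a b hab hb h
        have hne : mapGLK K (g ^ b) (Fl k) ⊓ mapGLK K (g ^ a) (Fl k) ≠ ⊥ := by
          rw [h, inf_idem]
          intro h0
          have := sg_finrank_mapGLK (g ^ a) (Fl k)
          rw [h0, finrank_bot, hdim k hk (by omega)] at this
          omega
        have h2 := (hdich _ ⟨b, by simp⟩ _ ⟨a, by simp⟩ hne).1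
        have h3 : (g ^ a)⁻¹ * g ^ b = g ^ (b - a) := by
          rw [inv_mul_eq_iff_eq_mul, ← pow_add]; congr 1; omega
        rw [h3, ← pow_mul] at h2
        have h4 := orderOf_dvd_of_pow_eq_one h2
        rw [hgord] at h4
        rcases Nat.eq_zero_or_pos ((b - a) * 2) with h5 | h5
        · omega
        · have := Nat.le_of_dvd h5 h4
          omega
      intro a ha b hb hab
      rw [Finset.mem_coe, Finset.mem_range] at ha hb
      have hk' := congrFun hab ⟨k - 1, by omega⟩
      simp only [Nat.sub_add_cancel hk] at hk'
      rcases le_total a b with h | h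
      · exact hlem a b h hb hk'.symm
      · exact (hlem b a h ha hk').symm
  · rintro G ⟨A, hA, rfl⟩ G' ⟨B, hB, rfl⟩ hne
    apply sg_dist k hk hdeg Fl hdim hmono
    by_contra h
    apply hne
    funext j
    exact (hdich A hA B hB h).2 _
end

section
/- Let K be a finite field with char(K) ≠ 2, L a field extension of K of finite degree k ≥ 1, and S = {restrictScalars_K(l) : l a 1-dimensional L-subspace of L²} the planar spread of the 2k-dimensional K-space L². Let M ∈ GL(2, L) have irreducible characteristic polynomial over L and multiplicative order |L|² − 1, and set H̄ = ⟨M^{|L|−1}⟩, acting K-linearly on L². Let F = (F_1, …, F_{2k−1}) and F′ = (F′_1, …, F′_{2k−1}) be full flags of K-subspaces of L² such that F_k, F′_k ∈ S lie in different orbits of the action of H̄ on S. Then the flag code C = Orb_{H̄}(F) ∪ Orb_{H̄}(F′) is a disjoint union, has cardinality |L| + 1 (the largest possible size), and any two distinct flags in C have flag distance exactly 2k² (the maximum possible); in particular C is an optimum distance full flag code with the largest possible size. -/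
open Module

section helpers

variable {K L : Type*} [Field K] [Field L] [Algebra K L]

lemma mem_mapGLK (A : GL (Fin 2) L) (U : Submodule K (Fin 2 → L)) (x : Fin 2 → L) :
    x ∈ mapGLK K A U ↔ ∃ y ∈ U, (A : Matrix (Fin 2) (Fin 2) L).mulVec y = x := by
  simp [mapGLK, Submodule.mem_map]

lemma mapGLK_mul (A B : GL (Fin 2) L) (U : Submodule K (Fin 2 → L)) :
    mapGLK K (A * B) U = mapGLK K A (mapGLK K B U) := by
  ext x
  simp only [mem_mapGLK]
  constructor
  · rintro ⟨y, hy, rfl⟩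
    exact ⟨_, ⟨y, hy, rfl⟩, by rw [Matrix.mulVec_mulVec, Units.val_mul]⟩
  · rintro ⟨_, ⟨y, hy, rfl⟩, rfl⟩
    exact ⟨y, hy, by rw [Matrix.mulVec_mulVec, Units.val_mul]⟩

lemma mapGLK_one (U : Submodule K (Fin 2 → L)) : mapGLK K (1 : GL (Fin 2) L) U = U := by
  ext x
  simp [mem_mapGLK]

lemma mapGLK_neg_one (U : Submodule K (Fin 2 → L)) :
    mapGLK K (-1 : GL (Fin 2) L) U = U := by
  ext x
  simp only [mem_mapGLK, Units.val_neg, Units.val_one, Matrix.neg_mulVec, Matrix.one_mulVec]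
  constructor
  · rintro ⟨y, hy, rfl⟩
    exact U.neg_mem hy
  · intro hx
    exact ⟨-x, U.neg_mem hx, by simp⟩

lemma mapGLK_mono (A : GL (Fin 2) L) {U W : Submodule K (Fin 2 → L)} (h : U ≤ W) :
    mapGLK K A U ≤ mapGLK K A W := Submodule.map_mono h

lemma GL_mulVec_inj (A : GL (Fin 2) L) :
    Function.Injective ((A : Matrix (Fin 2) (Fin 2) L).mulVec) := by
  intro x y h
  have := congrArg (((A⁻¹ : GL (Fin 2) L) : Matrix (Fin 2) (Fin 2) L).mulVec) h
  simpa only [Matrix.mulVec_mulVec, ← Units.val_mul, inv_mul_cancel, Units.val_one,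
    Matrix.one_mulVec] using this

lemma finrank_mapGLK (A : GL (Fin 2) L) (U : Submodule K (Fin 2 → L)) :
    finrank K (mapGLK K A U) = finrank K U := by
  unfold mapGLK
  refine (LinearEquiv.finrank_eq (Submodule.equivMapOfInjective _ ?_ U)).symm
  intro x y h
  exact GL_mulVec_inj A (by simpa using h)

lemma mapGLK_spread (A : GL (Fin 2) L) {U : Submodule K (Fin 2 → L)}
    (h : U ∈ fieldReductionSpread K L) : mapGLK K A U ∈ fieldReductionSpread K L := by
  obtain ⟨l, hl, rfl⟩ := h
  refine ⟨l.map (Matrix.toLin' (A : Matrix (Fin 2) (Fin 2) L)), ?_, ?_⟩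
  · have := finrank_mapGLK (K := L) A l
    rw [← hl, ← this]
    rfl
  · ext x
    simp [mem_mapGLK]

lemma spread_inf {U W : Submodule K (Fin 2 → L)}
    (hU : U ∈ fieldReductionSpread K L) (hW : W ∈ fieldReductionSpread K L)
    (h : U ≠ W) : U ⊓ W = ⊥ := by
  obtain ⟨l, hl, rfl⟩ := hU
  obtain ⟨l', hl', rfl⟩ := hW
  rw [eq_bot_iff]
  rintro x ⟨hx, hx'⟩
  simp only [SetLike.mem_coe, Submodule.restrictScalars_mem] at hx hx'
  rw [Submodule.mem_bot]
  by_contra hx0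
  apply h
  have key : ∀ m : Submodule L (Fin 2 → L), finrank L m = 1 → x ∈ m →
      m = Submodule.span L {x} := by
    intro m hm hxm
    symm
    apply Submodule.eq_of_le_of_finrank_eq
    · rw [Submodule.span_le]; simpa using hxm
    · rw [hm, finrank_span_singleton hx0]
  rw [key l hl hx, key l' hl' hx']

lemma sum_aux (n : ℕ) : ∑ i ∈ Finset.range n, 2 * (n - i) = n * (n + 1) := by
  have := Finset.sum_range_reflect (fun i => 2 * (i + 1)) n
  rw [Finset.sum_congr rfl (g := fun i => 2 * (n - 1 - i + 1))]
  · rw [this]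
    clear this
    induction n with
    | zero => simp
    | succ n ih => rw [Finset.sum_range_succ, ih]; ring
  · intro i hi
    have := Finset.mem_range.1 hi
    omega

lemma sum_aux2 (n : ℕ) : ∑ i ∈ Finset.range n, 2 * (i + 1) = n * (n + 1) := by
  induction n with
  | zero => simp
  | succ n ih => rw [Finset.sum_range_succ, ih]; ring

lemma flag_dist {V : Type*} [AddCommGroup V] [Module K V] [FiniteDimensional K V]
    (k : ℕ) (hk : 1 ≤ k) (hV : finrank K V = 2 * k) (P Q : ℕ → Submodule K V)
    (hP : ∀ i, 1 ≤ i → i ≤ 2 * k - 1 → finrank K (P i) = i)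
    (hQ : ∀ i, 1 ≤ i → i ≤ 2 * k - 1 → finrank K (Q i) = i)
    (mP : ∀ i j, 1 ≤ i → i ≤ j → j ≤ 2 * k - 1 → P i ≤ P j)
    (mQ : ∀ i j, 1 ≤ i → i ≤ j → j ≤ 2 * k - 1 → Q i ≤ Q j)
    (h : P k ⊓ Q k = ⊥) :
    ∑ j : Fin (2 * k - 1), subspaceDist (P (j.val + 1)) (Q (j.val + 1)) = 2 * k ^ 2 := by
  have low : ∀ i, 1 ≤ i → i ≤ k → subspaceDist (P i) (Q i) = 2 * i := by
    intro i h1 h2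
    have : P i ⊓ Q i = ⊥ := by
      rw [eq_bot_iff, ← h]
      exact inf_le_inf (mP i k h1 h2 (by omega)) (mQ i k h1 h2 (by omega))
    unfold subspaceDist
    rw [this, hP i h1 (by omega), hQ i h1 (by omega), finrank_bot]
    omega
  have htop : P k ⊔ Q k = ⊤ := by
    apply Submodule.eq_top_of_finrank_eq
    have := Submodule.finrank_sup_add_finrank_inf_eq (P k) (Q k)
    rw [h, finrank_bot, hP k hk (by omega), hQ k hk (by omega)] at this
    omega
  have high : ∀ i, k ≤ i → i ≤ 2 * k - 1 → subspaceDist (P i) (Q i) = 4 * k - 2 * i := by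
    intro i h1 h2
    have ht : P i ⊔ Q i = ⊤ := by
      rw [eq_top_iff, ← htop]
      exact sup_le_sup (mP k i hk h1 h2) (mQ k i hk h1 h2)
    have := Submodule.finrank_sup_add_finrank_inf_eq (P i) (Q i)
    unfold subspaceDist
    rw [ht, finrank_top, hV, hP i (by omega) h2, hQ i (by omega) h2] at this
    rw [hP i (by omega) h2, hQ i (by omega) h2]
    omega
  rw [Finset.sum_fin_eq_sum_range]
  obtain ⟨n, rfl⟩ : ∃ n, k = n + 1 := ⟨k - 1, by omega⟩
  have e : 2 * (n + 1) - 1 = (n + 1) + n := by omega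
  rw [e, Finset.sum_range_add]
  have s1 : ∀ x ∈ Finset.range (n + 1), (if h : x < n + 1 + n then
      subspaceDist (P (x + 1)) (Q (x + 1)) else 0) = 2 * (x + 1) := by
    intro x hx
    have := Finset.mem_range.1 hx
    rw [dif_pos (by omega), low _ (by omega) (by omega)]
  have s2 : ∀ x ∈ Finset.range n, (if h : n + 1 + x < n + 1 + n then
      subspaceDist (P (n + 1 + x + 1)) (Q (n + 1 + x + 1)) else 0) = 2 * (n - x) := by
    intro x hx
    have := Finset.mem_range.1 hx
    rw [dif_pos (by omega), high _ (by omega) (by omega)]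
    omega
  rw [Finset.sum_congr rfl s1, Finset.sum_congr rfl s2, sum_aux, sum_aux2]
  ring

/-- An element commuting with `M` (without eigenvectors) with an eigenvector is scalar. -/
lemma scalar_of_eig (M : GL (Fin 2) L)
    (hirr : Irreducible (Matrix.charpoly (M : Matrix (Fin 2) (Fin 2) L)))
    (A : GL (Fin 2) L) (hc : Commute A M) (c : L) (v : Fin 2 → L) (hv : v ≠ 0)
    (hA : (A : Matrix (Fin 2) (Fin 2) L).mulVec v = c • v) :
    (A : Matrix (Fin 2) (Fin 2) L) = c • 1 := by
  have noeig : ∀ d : L, (M : Matrix (Fin 2) (Fin 2) L).mulVec v ≠ d • v := by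
    intro d hd
    have hroot : (Matrix.charpoly (M : Matrix (Fin 2) (Fin 2) L)).IsRoot d := by
      rw [Polynomial.IsRoot, Matrix.eval_charpoly]
      apply Matrix.exists_mulVec_eq_zero_iff.1
      refine ⟨v, hv, ?_⟩
      rw [Matrix.sub_mulVec, hd]
      simp
    have := Polynomial.degree_eq_one_of_irreducible_of_root hirr hroot
    rw [Matrix.charpoly_degree_eq_dim] at this
    simp at this
  have hli : LinearIndependent L ![v, (M : Matrix (Fin 2) (Fin 2) L).mulVec v] := by
    rw [LinearIndependent.pair_iff' hv]
    intro a ha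
    exact noeig a ha.symm
  have hsp := hli.span_eq_top_of_card_eq_finrank (by simp)
  have hc' : (A : Matrix (Fin 2) (Fin 2) L) * M = M * A := by
    have := congrArg (fun x : GL (Fin 2) L => (x : Matrix (Fin 2) (Fin 2) L)) hc.eq
    simpa using this
  have : Matrix.toLin' (A : Matrix (Fin 2) (Fin 2) L)
      = Matrix.toLin' (c • 1 : Matrix (Fin 2) (Fin 2) L) := by
    apply LinearMap.ext_on_range hsp
    intro i
    fin_cases i
    · simp [hA, Matrix.smul_mulVec]
    · simp only [Fin.mk_one, Matrix.cons_val_one, Matrix.toLin'_apply, Matrix.mulVec_mulVec, hc',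
        Matrix.cons_val_fin_one, Matrix.smul_mulVec, Matrix.one_mulVec]
      rw [← Matrix.mulVec_mulVec, hA, Matrix.mulVec_smul]
      simp [mul_add, mul_assoc]
  exact Matrix.toLin'.injective this

end helpers

section main

variable {K L : Type*} [Field K] [Field L] [Fintype L] [Algebra K L]

lemma fix_spread (M : GL (Fin 2) L)
    (hirr : Irreducible (Matrix.charpoly (M : Matrix (Fin 2) (Fin 2) L)))
    (hord : orderOf M = Fintype.card L ^ 2 - 1)
    (A : GL (Fin 2) L) (hA : A ∈ Subgroup.zpowers (M ^ (Fintype.card L - 1)))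
    (U : Submodule K (Fin 2 → L)) (hU : U ∈ fieldReductionSpread K L)
    (h : mapGLK K A U = U) : A = 1 ∨ A = -1 := by
  obtain ⟨l, hl, rfl⟩ := hU
  obtain ⟨⟨v, hvl⟩, hv, hsp⟩ := finrank_eq_one_iff'.1 hl
  have hv0 : v ≠ 0 := by
    intro h0; apply hv; ext1; exact h0
  have : (A : Matrix (Fin 2) (Fin 2) L).mulVec v ∈ mapGLK K A (l.restrictScalars K) :=
    (mem_mapGLK _ _ _).2 ⟨v, hvl, rfl⟩
  rw [h] at this
  obtain ⟨c, hc⟩ := hsp ⟨_, this⟩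
  have hc := congrArg Subtype.val hc
  simp only [SetLike.mk_smul_mk] at hc
  obtain ⟨z, rfl⟩ := Subgroup.mem_zpowers_iff.1 hA
  set A := (M ^ (Fintype.card L - 1)) ^ z with hAdef
  have hcomm : Commute A M := ((Commute.refl M).pow_left _).zpow_left _
  have hs := scalar_of_eig M hirr A hcomm c v hv0 hc.symm
  have hq : 1 < Fintype.card L := Fintype.one_lt_card
  have hpow : A ^ (Fintype.card L + 1) = 1 := by
    rw [hAdef, ← zpow_natCast, zpow_comm, zpow_natCast, ← pow_mul, mul_comm,
      ← Nat.sq_sub_sq, one_pow, ← hord, pow_orderOf_eq_one, one_zpow]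
  have hc0 : c ≠ 0 := by
    rintro rfl
    apply hv0
    apply GL_mulVec_inj A
    rw [← hc]; simp
  have hcp : c ^ (Fintype.card L + 1) = 1 := by
    have := congrArg (fun x : GL (Fin 2) L => (x : Matrix (Fin 2) (Fin 2) L) 0 0) hpow
    simpa [hs, smul_pow] using this
  have hc2 : c ^ 2 = 1 := by
    rw [pow_succ, FiniteField.pow_card] at hcp
    rw [sq]; exact hcp
  rcases (mul_self_eq_one_iff.1 ((sq c).symm.trans hc2)) with h1 | h1
  · left; ext1; rw [hs, h1]; simp
  · right; ext1; rw [hs, h1]; simp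

lemma half_pow (M : GL (Fin 2) L)
    (hirr : Irreducible (Matrix.charpoly (M : Matrix (Fin 2) (Fin 2) L)))
    (hord : orderOf M = Fintype.card L ^ 2 - 1) (m : ℕ) (hm : Fintype.card L + 1 = 2 * m) :
    (M ^ (Fintype.card L - 1)) ^ m = -1 := by
  have hq : 1 < Fintype.card L := Fintype.one_lt_card
  have hmul : Fintype.card L ^ 2 - 1 = (Fintype.card L - 1) * m * 2 := by
    rw [mul_assoc, mul_comm m, ← hm, mul_comm, ← Nat.sq_sub_sq, one_pow]
  set N := (M ^ (Fintype.card L - 1)) ^ m with hN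
  have h2 : N * N = 1 := by
    rw [← sq, hN, ← pow_mul, ← pow_mul, ← mul_assoc, ← hmul, ← hord, pow_orderOf_eq_one]
  have h1 : N ≠ 1 := by
    rw [hN, ← pow_mul]
    apply pow_ne_one_of_lt_orderOf
    · have : 0 < (Fintype.card L - 1) * m := Nat.mul_pos (by omega) (by omega)
      omega
    · rw [hord, hmul]
      have : 0 < (Fintype.card L - 1) * m := Nat.mul_pos (by omega) (by omega)
      omega
  have h2' : (N : Matrix (Fin 2) (Fin 2) L) * N = 1 := by
    rw [← Units.val_mul, h2, Units.val_one]
  obtain ⟨v, hv⟩ : ∃ v, (N : Matrix (Fin 2) (Fin 2) L).mulVec v - v ≠ 0 := by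
    by_contra hcon
    push Not at hcon
    apply h1
    ext1
    apply Matrix.toLin'.injective
    ext1 
    ext1
    simp [sub_eq_zero.1 (hcon _)]
  have hcomm : Commute N M := ((Commute.refl M).pow_left _).pow_left _
  have := scalar_of_eig M hirr N hcomm (-1) _ hv (by
    rw [Matrix.mulVec_sub, Matrix.mulVec_mulVec, h2', Matrix.one_mulVec]; simp)
  ext1; rw [this]; simp

/-- Full flags with middle space in the spread. -/
structure GoodFlag (k : ℕ) (Fl : ℕ → Submodule K (Fin 2 → L)) : Prop where
  dim : ∀ i, 1 ≤ i → i ≤ 2 * k - 1 → finrank K (Fl i) = i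
  mono : ∀ i j, 1 ≤ i → i ≤ j → j ≤ 2 * k - 1 → Fl i ≤ Fl j
  mid : Fl k ∈ fieldReductionSpread K L

lemma GoodFlag.map {k : ℕ} {Fl : ℕ → Submodule K (Fin 2 → L)} (h : GoodFlag k Fl)
    (A : GL (Fin 2) L) : GoodFlag k (fun i => mapGLK K A (Fl i)) where
  dim i h1 h2 := by rw [finrank_mapGLK, h.dim i h1 h2]
  mono i j h1 h2 h3 := mapGLK_mono A (h.mono i j h1 h2 h3)
  mid := mapGLK_spread A h.mid

lemma GoodFlag.dist [FiniteDimensional K L] {k : ℕ} (hk : 1 ≤ k) (hdeg : finrank K L = k)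
    {P Q : ℕ → Submodule K (Fin 2 → L)}
    (hP : GoodFlag k P) (hQ : GoodFlag k Q) (h : P k ≠ Q k) :
    ∑ j : Fin (2 * k - 1), subspaceDist (P (j.val + 1)) (Q (j.val + 1)) = 2 * k ^ 2 :=
  flag_dist k hk (by rw [finrank_pi_fintype]; simp [hdeg]) P Q hP.dim hQ.dim hP.mono hQ.mono
    (spread_inf hP.mid hQ.mid h)

/-- Two group elements agreeing on the middle space agree on all subspaces. -/
lemma agree_of_mid (M : GL (Fin 2) L)
    (hirr : Irreducible (Matrix.charpoly (M : Matrix (Fin 2) (Fin 2) L)))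
    (hord : orderOf M = Fintype.card L ^ 2 - 1)
    {A B : GL (Fin 2) L} (hA : A ∈ Subgroup.zpowers (M ^ (Fintype.card L - 1)))
    (hB : B ∈ Subgroup.zpowers (M ^ (Fintype.card L - 1)))
    {U : Submodule K (Fin 2 → L)} (hU : U ∈ fieldReductionSpread K L)
    (h : mapGLK K A U = mapGLK K B U) : B⁻¹ * A = 1 ∨ B⁻¹ * A = -1 := by
  apply fix_spread (K := K) M hirr hord _ (mul_mem (inv_mem hB) hA) U hU
  rw [mapGLK_mul, h, ← mapGLK_mul, inv_mul_cancel, mapGLK_one]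

lemma map_eq_of_pm {A B : GL (Fin 2) L} (h : B⁻¹ * A = 1 ∨ B⁻¹ * A = -1)
    (U : Submodule K (Fin 2 → L)) : mapGLK K A U = mapGLK K B U := by
  have : A = B * (B⁻¹ * A) := by group
  rw [this, mapGLK_mul]
  rcases h with h | h <;> rw [h]
  · rw [mapGLK_one]
  · rw [mapGLK_neg_one]

lemma orb_ncard (M : GL (Fin 2) L)
    (hirr : Irreducible (Matrix.charpoly (M : Matrix (Fin 2) (Fin 2) L)))
    (hord : orderOf M = Fintype.card L ^ 2 - 1) (m : ℕ) (hm : Fintype.card L + 1 = 2 * m)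
    {k : ℕ} (hk : 1 ≤ k) {Fl : ℕ → Submodule K (Fin 2 → L)} (h : GoodFlag k Fl) :
    (orbFlagKL (Subgroup.zpowers (M ^ (Fintype.card L - 1))) k Fl).ncard = m
    ∧ (orbFlagKL (Subgroup.zpowers (M ^ (Fintype.card L - 1))) k Fl).Finite := by
  have hq : 1 < Fintype.card L := Fintype.one_lt_card
  have hmm := half_pow M hirr hord m hm
  have hog : orderOf (M ^ (Fintype.card L - 1)) = 2 * m := by
    have e : Fintype.card L ^ 2 - 1 = (2 * m) * (Fintype.card L - 1) := by
      rw [← hm, ← Nat.sq_sub_sq, one_pow]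
    rw [orderOf_pow' _ (by omega), hord, e, Nat.gcd_mul_left_left, Nat.mul_div_cancel _ (by omega)]
  set g := M ^ (Fintype.card L - 1) with hg
  have himg : orbFlagKL (Subgroup.zpowers g) k Fl =
      (fun (i : ℕ) (j : Fin (2 * k - 1)) => mapGLK K (g ^ i) (Fl (j.val + 1))) ''
        (Finset.range m : Set ℕ) := by
    ext G
    constructor
    · rintro ⟨A, hA, rfl⟩
      obtain ⟨z, rfl⟩ := Subgroup.mem_zpowers_iff.1 hA
      have hm0 : (0 : ℤ) < m := by omega
      have hr := Int.emod_nonneg z hm0.ne'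
      have hr' := Int.emod_lt_of_pos z hm0
      refine ⟨(z % m).toNat, by simp; omega, ?_⟩
      funext j
      symm
      apply map_eq_of_pm
      have : (g ^ (z % m).toNat)⁻¹ * g ^ z = (-1) ^ (z / m) := by
        rw [← hmm, ← zpow_natCast, ← zpow_natCast, Int.toNat_of_nonneg hr, ← zpow_mul, ← zpow_neg,
          ← zpow_add]
        congr 1
        have := Int.emod_add_mul_ediv z m
        linarith
      rw [this]
      rcases Int.even_or_odd (z / m) with ho | ho
      · left; exact ho.neg_one_zpow
      · right
        obtain ⟨t, ht⟩ := ho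
        rw [ht, zpow_add, zpow_mul]; simp
    · rintro ⟨i, _, rfl⟩
      exact ⟨g ^ i, Subgroup.npow_mem_zpowers _ _, rfl⟩
  have key : ∀ i j : ℕ, i ≤ j → j < m → mapGLK K (g ^ j) (Fl k) = mapGLK K (g ^ i) (Fl k) →
      i = j := by
    intro i j hij hj he
    have h1 := agree_of_mid M hirr hord (Subgroup.npow_mem_zpowers g j)
      (Subgroup.npow_mem_zpowers g i) h.mid he
    have h2 : (g ^ i)⁻¹ * g ^ j = g ^ (j - i) := by
      rw [pow_sub _ hij]; exact ((Commute.refl g).pow_pow i j).inv_left.eq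
    rw [h2] at h1
    have h3 : g ^ ((j - i) * 2) = 1 := by
      rw [pow_mul]
      rcases h1 with h1 | h1 <;> rw [h1] <;> simp
    have := orderOf_dvd_of_pow_eq_one h3
    rw [hog] at this
    by_contra hne
    have := Nat.le_of_dvd (by omega) this
    omega
  have hinj : Set.InjOn (fun (i : ℕ) (j : Fin (2 * k - 1)) => mapGLK K (g ^ i) (Fl (j.val + 1)))
      (Finset.range m : Set ℕ) := by
    intro i hi j hj he
    have he := congrFun he ⟨k - 1, by omega⟩
    simp only [Nat.sub_add_cancel hk] at he
    simp only [Finset.coe_range, Set.mem_Iio] at hi hj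
    rcases le_total i j with hij | hij
    · exact key i j hij hj he.symm
    · exact (key j i hij hi he).symm
  rw [himg]
  refine ⟨?_, (Finset.finite_toSet _).image _⟩
  rw [hinj.ncard_image, Set.ncard_coe_finset, Finset.card_range]

end main

/-- Let `K` be a finite field of odd characteristic, `L/K` an extension of
degree `k ≥ 1`, `S` the planar spread of the `K`-space `L²`, `M ∈ GL(2, L)` a Singer cycle
and `H̄ = ⟨M^{|L|−1}⟩`. Let `F` and `F′` be full flags of `K`-subspaces of `L²` whose middle
subspaces `F_k, F′_k ∈ S` lie in different `H̄`-orbits. Then `Orb_{H̄}(F)` and `Orb_{H̄}(F′)`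
are disjoint, their union `C` has cardinality `|L| + 1` (the largest possible size), and any
two distinct flags in `C` are at flag distance exactly `2k²`. -/
theorem union_of_two_singer_orbit_flag_codes_char_ne_two
    {K L : Type*} [Field K] [Fintype K] [Field L] [Fintype L] [Algebra K L]
    (hchar : ringChar K ≠ 2)
    (k : ℕ) (hk : 1 ≤ k) (hdeg : finrank K L = k)
    (M : GL (Fin 2) L)
    (hirr : Irreducible (Matrix.charpoly (M : Matrix (Fin 2) (Fin 2) L)))
    (hord : orderOf M = Fintype.card L ^ 2 - 1)
    (Fl Fl' : ℕ → Submodule K (Fin 2 → L))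
    (hdim : ∀ i, 1 ≤ i → i ≤ 2 * k - 1 → finrank K (Fl i) = i)
    (hmono : ∀ i j, 1 ≤ i → i < j → j ≤ 2 * k - 1 → Fl i < Fl j)
    (hdim' : ∀ i, 1 ≤ i → i ≤ 2 * k - 1 → finrank K (Fl' i) = i)
    (hmono' : ∀ i j, 1 ≤ i → i < j → j ≤ 2 * k - 1 → Fl' i < Fl' j)
    (hFk : Fl k ∈ fieldReductionSpread K L)
    (hFk' : Fl' k ∈ fieldReductionSpread K L)
    (hdiff : ∀ A ∈ Subgroup.zpowers (M ^ (Fintype.card L - 1)),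
      mapGLK K A (Fl k) ≠ Fl' k) :
    Disjoint (orbFlagKL (Subgroup.zpowers (M ^ (Fintype.card L - 1))) k Fl)
        (orbFlagKL (Subgroup.zpowers (M ^ (Fintype.card L - 1))) k Fl')
    ∧ (orbFlagKL (Subgroup.zpowers (M ^ (Fintype.card L - 1))) k Fl
        ∪ orbFlagKL (Subgroup.zpowers (M ^ (Fintype.card L - 1))) k Fl').ncard
        = Fintype.card L + 1
    ∧ ∀ G ∈ orbFlagKL (Subgroup.zpowers (M ^ (Fintype.card L - 1))) k Fl
        ∪ orbFlagKL (Subgroup.zpowers (M ^ (Fintype.card L - 1))) k Fl',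
      ∀ G' ∈ orbFlagKL (Subgroup.zpowers (M ^ (Fintype.card L - 1))) k Fl
        ∪ orbFlagKL (Subgroup.zpowers (M ^ (Fintype.card L - 1))) k Fl',
        G ≠ G' → ∑ j : Fin (2 * k - 1), subspaceDist (G j) (G' j) = 2 * k ^ 2 := by
  have hFD : FiniteDimensional K L := Module.Finite.of_finite
  have hodd : ∃ m, Fintype.card L + 1 = 2 * m := by
    have h2 : ringChar L ≠ 2 := by rwa [← Algebra.ringChar_eq K L]
    have := FiniteField.odd_card_of_char_ne_two h2
    exact ⟨(Fintype.card L + 1) / 2, by omega⟩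
  obtain ⟨m, hm⟩ := hodd
  have hF : GoodFlag k Fl := ⟨hdim, fun i j h1 h2 h3 => by
    rcases h2.eq_or_lt with rfl | h2
    · exact le_rfl
    · exact (hmono i j h1 h2 h3).le, hFk⟩
  have hF' : GoodFlag k Fl' := ⟨hdim', fun i j h1 h2 h3 => by
    rcases h2.eq_or_lt with rfl | h2
    · exact le_rfl
    · exact (hmono' i j h1 h2 h3).le, hFk'⟩
  have hne : ∀ A ∈ Subgroup.zpowers (M ^ (Fintype.card L - 1)),
      ∀ B ∈ Subgroup.zpowers (M ^ (Fintype.card L - 1)),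
      mapGLK K A (Fl k) ≠ mapGLK K B (Fl' k) := by
    intro A hA B hB he
    apply hdiff (B⁻¹ * A) (mul_mem (inv_mem hB) hA)
    rw [mapGLK_mul, he, ← mapGLK_mul, inv_mul_cancel, mapGLK_one]
  have hdisj : Disjoint (orbFlagKL (Subgroup.zpowers (M ^ (Fintype.card L - 1))) k Fl)
        (orbFlagKL (Subgroup.zpowers (M ^ (Fintype.card L - 1))) k Fl') := by
    rw [Set.disjoint_left]
    rintro G ⟨A, hA, rfl⟩ ⟨B, hB, he⟩
    have he := congrFun he ⟨k - 1, by omega⟩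
    simp only [Nat.sub_add_cancel hk] at he
    exact hne A hA B hB he
  have hsame : ∀ {P : ℕ → Submodule K (Fin 2 → L)}, GoodFlag k P →
      ∀ G ∈ orbFlagKL (Subgroup.zpowers (M ^ (Fintype.card L - 1))) k P,
      ∀ G' ∈ orbFlagKL (Subgroup.zpowers (M ^ (Fintype.card L - 1))) k P,
      G ≠ G' → ∑ j : Fin (2 * k - 1), subspaceDist (G j) (G' j) = 2 * k ^ 2 := by
    rintro P hP G ⟨A, hA, rfl⟩ G' ⟨B, hB, rfl⟩ hGG
    apply (hP.map A).dist hk hdeg (hP.map B)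
    intro he
    apply hGG
    funext j
    exact map_eq_of_pm (agree_of_mid M hirr hord hA hB hP.mid he) _
  refine ⟨hdisj, ?_, ?_⟩
  · obtain ⟨c1, f1⟩ := orb_ncard M hirr hord m hm hk hF
    obtain ⟨c2, f2⟩ := orb_ncard M hirr hord m hm hk hF'
    rw [Set.ncard_union_eq hdisj f1 f2, c1, c2, hm]
    omega
  · rintro G (hG | hG) G' (hG' | hG') hGG
    · exact hsame hF G hG G' hG' hGG
    · obtain ⟨A, hA, rfl⟩ := hG
      obtain ⟨B, hB, rfl⟩ := hG'
      apply (hF.map A).dist hk hdeg (hF'.map B)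
      exact hne A hA B hB
    · obtain ⟨A, hA, rfl⟩ := hG
      obtain ⟨B, hB, rfl⟩ := hG'
      apply (hF'.map A).dist hk hdeg (hF.map B)
      exact (hne B hB A hA).symm
    · exact hsame hF' G hG G' hG' hGG
end
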